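/- Let ψ be a symmetric cone obstacle with valley [0,s] and peak A for some A > 0 and s ∈ (0,1/2). Define for B > 0 the ratio R(B) := (∫₀^B t/(√(B−t)·(1+t²)^{5/4}) dt) / (2·∫₀^B 1/(√(B−t)·(1+t²)^{5/4}) dt). Then sup_{B>0} R(B) is finite, and if sup_{x∈(0,1)} ψ(x) > sup_{B>0} R(B), then the infimum inf_{u ∈ G_ψ} E(u) is not attained. -/

import Mathlib

open MeasureTheory Set Topology Filter

noncomputable section

/-- A function of class `W^{2,2}(0,1)`, identified with its `C¹([0,1])` representative:
`u` has weak derivatives `du`, `ddu` (encoded through the fundamental theorem of calculus)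
with `du, ddu ∈ L¹(0,1)` and `ddu ∈ L²(0,1)`. -/
structure W22 where
  u : ℝ → ℝ
  du : ℝ → ℝ
  ddu : ℝ → ℝ
  du_int : IntegrableOn du (Icc (0:ℝ) 1)
  ddu_int : IntegrableOn ddu (Icc (0:ℝ) 1)
  ddu_sq : IntegrableOn (fun x => (ddu x)^2) (Icc (0:ℝ) 1)
  ftc_u : ∀ x ∈ Icc (0:ℝ) 1, u x = u 0 + ∫ s in (0:ℝ)..x, du s
  ftc_du : ∀ x ∈ Icc (0:ℝ) 1, du x = du 0 + ∫ s in (0:ℝ)..x, ddu s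

/-- The elastic energy of a graph. -/
def graphE (f : W22) : ℝ :=
  ∫ x in Ioo (0:ℝ) 1, (f.ddu x)^2 / (1 + (f.du x)^2) ^ ((5:ℝ)/2)

/-- The length of a graph. -/
def graphLen (f : W22) : ℝ :=
  ∫ x in Ioo (0:ℝ) 1, Real.sqrt (1 + (f.du x)^2)

/-- The length-penalized elastic energy of a graph. -/
def graphPE (ε : ℝ) (f : W22) : ℝ := graphE f + ε * graphLen f

/-- Membership in the admissible class `G_ψ`. -/
def MemG (ψ : ℝ → ℝ) (f : W22) : Prop :=
  f.u 0 = 0 ∧ f.u 1 = 0 ∧ ∀ x ∈ Icc (0:ℝ) 1, ψ x ≤ f.u x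

/-- An admissible obstacle. -/
structure Admissible (ψ : ℝ → ℝ) : Prop where
  cont : ContinuousOn ψ (Icc 0 1)
  neg0 : ψ 0 < 0
  neg1 : ψ 1 < 0
  pos : ∃ x ∈ Icc (0:ℝ) 1, 0 < ψ x
  osd : ∃ C : ℝ, ∀ x ∈ Ioo (0:ℝ) 1,
      (∃ d : ℝ, |d| ≤ C ∧ HasDerivWithinAt ψ d (Ici x) x) ∧
      (∃ d : ℝ, |d| ≤ C ∧ HasDerivWithinAt ψ d (Iic x) x)

/-- `‖ψ'‖_∞`, the smallest uniform bound for the one-sided derivatives of `ψ` on `(0,1)`. -/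
def obstNorm (ψ : ℝ → ℝ) : ℝ :=
  sInf {C : ℝ | 0 ≤ C ∧ ∀ x ∈ Ioo (0:ℝ) 1, ∀ d : ℝ,
    (HasDerivWithinAt ψ d (Ici x) x ∨ HasDerivWithinAt ψ d (Iic x) x) → |d| ≤ C}

/-- A planar curve on `(0,1)` of class `W^{1,1}((0,1);ℝ²)`. -/
structure Curve1 where
  x : ℝ → ℝ
  y : ℝ → ℝ
  dx : ℝ → ℝ
  dy : ℝ → ℝ
  dx_int : IntegrableOn dx (Icc (0:ℝ) 1)
  dy_int : IntegrableOn dy (Icc (0:ℝ) 1)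
  ftc_x : ∀ t ∈ Icc (0:ℝ) 1, x t = x 0 + ∫ s in (0:ℝ)..t, dx s
  ftc_y : ∀ t ∈ Icc (0:ℝ) 1, y t = y 0 + ∫ s in (0:ℝ)..t, dy s

/-- A planar curve of class `W^{1,1}((0,1);ℝ²) ∩ W^{2,1}_loc((0,1);ℝ²)`. -/
structure Curve extends Curve1 where
  ddx : ℝ → ℝ
  ddy : ℝ → ℝ
  ddx_loc : ∀ a b : ℝ, 0 < a → b < 1 → IntegrableOn ddx (Icc a b)
  ddy_loc : ∀ a b : ℝ, 0 < a → b < 1 → IntegrableOn ddy (Icc a b)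
  ftc_dx : ∀ a ∈ Ioo (0:ℝ) 1, ∀ t ∈ Ioo (0:ℝ) 1, dx t = dx a + ∫ s in a..t, ddx s
  ftc_dy : ∀ a ∈ Ioo (0:ℝ) 1, ∀ t ∈ Ioo (0:ℝ) 1, dy t = dy a + ∫ s in a..t, ddy s

/-- `|γ'(t)|`. -/
def speed1 (γ : Curve1) (t : ℝ) : ℝ := Real.sqrt ((γ.dx t)^2 + (γ.dy t)^2)

/-- The length `L(γ) = ∫₀¹ |γ'| dt`, as an extended real number. -/
def len1E (γ : Curve1) : ENNReal := ∫⁻ t in Ioo (0:ℝ) 1, ENNReal.ofReal (speed1 γ t)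

/-- The length `L(γ)`, as a real number. -/
def len1 (γ : Curve1) : ℝ := ∫ t in Ioo (0:ℝ) 1, speed1 γ t

def lenE (γ : Curve) : ENNReal := len1E γ.toCurve1

/-- The integrand `⟨γ'', N_γ⟩²/|γ'|³` of the elastic energy. -/
def elInt (γ : Curve) (t : ℝ) : ℝ :=
  (γ.dx t * γ.ddy t - γ.dy t * γ.ddx t)^2 / ((γ.dx t)^2 + (γ.dy t)^2) ^ ((5:ℝ)/2)

/-- Elastic energy of a curve, as an extended real number. -/
def elE (γ : Curve) : ENNReal := ∫⁻ t in Ioo (0:ℝ) 1, ENNReal.ofReal (elInt γ t)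

/-- The length-penalized elastic energy `E_ε = E + ε·L`. -/
def penE (ε : ℝ) (γ : Curve) : ENNReal := elE γ + ENNReal.ofReal ε * lenE γ

/-- A curve is immersed if `|γ'| > ε` on `(0,1)` for some `ε > 0`. -/
def Curve.Immersed (γ : Curve) : Prop :=
  ∃ ε > 0, ∀ t ∈ Ioo (0:ℝ) 1, ε < speed1 γ.toCurve1 t

/-- `u` lies in `W^{2,2}_loc(c,d)` with weak derivatives `du`, `ddu`. -/
structure W22locOn (u du ddu : ℝ → ℝ) (c d : ℝ) : Prop where
  du_loc : ∀ a b : ℝ, c < a → b < d → IntegrableOn du (Icc a b)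
  ddu_loc : ∀ a b : ℝ, c < a → b < d → IntegrableOn ddu (Icc a b)
  ddu_sq : ∀ a b : ℝ, c < a → b < d → IntegrableOn (fun t => (ddu t)^2) (Icc a b)
  ftc_u : ∀ a ∈ Ioo c d, ∀ t ∈ Ioo c d, u t = u a + ∫ s in a..t, du s
  ftc_du : ∀ a ∈ Ioo c d, ∀ t ∈ Ioo c d, du t = du a + ∫ s in a..t, ddu s

/-- `γ` is a pseudograph. -/
def Pseudograph (γ : Curve) : Prop :=
  γ.Immersed ∧ (∀ t ∈ Ioo (0:ℝ) 1, 0 ≤ γ.dx t) ∧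
  ∀ a b : ℝ, 0 ≤ a → a < b → b ≤ 1 → (∀ t ∈ Ioo a b, 0 < γ.dx t) →
    ∃ u du ddu : ℝ → ℝ, W22locOn u du ddu (γ.x a) (γ.x b) ∧
      ∀ t ∈ Ioo a b, u (γ.x t) = γ.y t

/-- Membership in `P_ψ`. -/
def MemP (ψ : ℝ → ℝ) (γ : Curve) : Prop :=
  Pseudograph γ ∧ γ.x 0 = 0 ∧ γ.y 0 = 0 ∧ γ.x 1 = 1 ∧ γ.y 1 = 0 ∧
  ∀ t ∈ Icc (0:ℝ) 1, ψ (γ.x t) ≤ γ.y t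

/-- `v : (a,b) → (c,d)` is invertible in `W^{1,1}` (increasing case): it has an
inverse `w` which is again of class `W^{1,1}`. -/
def InvertibleW11On (v : ℝ → ℝ) (a b c d : ℝ) : Prop :=
  ∃ w dw : ℝ → ℝ, IntegrableOn dw (Icc c d) ∧
    (∀ s ∈ Icc c d, w s = w c + ∫ r in c..s, dw r) ∧
    (∀ t ∈ Ioo a b, v t ∈ Ioo c d ∧ w (v t) = t) ∧
    (∀ s ∈ Ioo c d, w s ∈ Ioo a b ∧ v (w s) = s)

/-- `γ ∈ M_{γ₀}`: a `∩`-shaped curve above `γ₀` with parameters `β₁, β₂` and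
graph reparametrization `u`. -/
structure CapAbove (γ : Curve1) (γ₀ : Curve) (β₁ β₂ : ℝ) (u : ℝ → ℝ) : Prop where
  ep0 : γ.x 0 = 0 ∧ γ.y 0 = 0
  ep1 : γ.x 1 = 1 ∧ γ.y 1 = 0
  hβ : 0 ≤ β₁ ∧ β₁ < β₂ ∧ β₂ ≤ 1
  left : ∀ t ∈ Icc (0:ℝ) β₁, γ.x t = 0
  right : ∀ t ∈ Icc β₂ (1:ℝ), γ.x t = 1
  inv : InvertibleW11On γ.x β₁ β₂ 0 1
  graph : ∀ t ∈ Ioo β₁ β₂, u (γ.x t) = γ.y t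
  ucont : ContinuousOn u (Icc (0:ℝ) 1)
  above : ∀ t ∈ Icc (0:ℝ) 1, γ₀.y t ≤ u (γ₀.x t)

/-- A `∩`-shaped pseudograph with parameters `β₁, β₂` and graph reparametrization `u`
(with weak derivatives `du`, `ddu`). -/
structure CapShaped (γ : Curve) (β₁ β₂ : ℝ) (u du ddu : ℝ → ℝ) : Prop where
  hβ : 0 ≤ β₁ ∧ β₁ < β₂ ∧ β₂ ≤ 1
  left : ∀ t ∈ Icc (0:ℝ) β₁, γ.x t = 0
  right : ∀ t ∈ Icc β₂ (1:ℝ), γ.x t = 1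
  pos : ∀ t ∈ Ioo β₁ β₂, 0 < γ.dx t
  graph : ∀ t ∈ Ioo β₁ β₂, u (γ.x t) = γ.y t
  reg : W22locOn u du ddu 0 1

/-- `G(x) = ∫₀ˣ (1+s²)^{-5/4} ds`. -/
def Gfun (x : ℝ) : ℝ := ∫ s in (0:ℝ)..x, ((1 + s^2) ^ (-(5:ℝ)/4) : ℝ)

/-- `c₀ = ∫_ℝ (1+s²)^{-5/4} ds`. -/
def c0 : ℝ := ∫ s : ℝ, ((1 + s^2) ^ (-(5:ℝ)/4) : ℝ)

/-- The inverse of `G`. -/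
def Ginv : ℝ → ℝ := Function.invFun Gfun

/-- The ratio `R(B)` from the nonexistence theorem. -/
def ratio (B : ℝ) : ℝ :=
  (∫ t in (0:ℝ)..B, t / (Real.sqrt (B - t) * (1 + t^2) ^ ((5:ℝ)/4))) /
  (2 * ∫ t in (0:ℝ)..B, 1 / (Real.sqrt (B - t) * (1 + t^2) ^ ((5:ℝ)/4)))

/-- The symmetric cone obstacle with valley `[0,s]` and peak `A`. -/
def coneObstacle (A s : ℝ) : ℝ → ℝ := fun x =>
  if x ≤ 1/2 then A / (1/2 - s) * (x - s) else A / (1/2 - s) * (1 - s - x)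

/-- `f` is, on `[0,1]`, a primitive of the integrable function `f'`. -/
structure IsPrim (f f' : ℝ → ℝ) : Prop where
  int : IntegrableOn f' (Icc (0:ℝ) 1)
  ftc : ∀ x ∈ Icc (0:ℝ) 1, f x = f 0 + ∫ t in (0:ℝ)..x, f' t

lemma intervalIntegrable_of_Icc {f : ℝ → ℝ} (hf : IntegrableOn f (Icc (0:ℝ) 1)) {a b : ℝ}
    (ha : a ∈ Icc (0:ℝ) 1) (hb : b ∈ Icc (0:ℝ) 1) : IntervalIntegrable f volume a b := by
  rw [intervalIntegrable_iff]
  refine hf.mono_set ?_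
  exact uIoc_subset_uIcc.trans (ordConnected_Icc.uIcc_subset ha hb)

lemma AbsolutelyContinuousOnInterval.congr_Icc {f g : ℝ → ℝ}
    (hf : AbsolutelyContinuousOnInterval f 0 1) (h : ∀ x ∈ Icc (0:ℝ) 1, f x = g x) :
    AbsolutelyContinuousOnInterval g 0 1 := by
  rw [absolutelyContinuousOnInterval_iff] at hf ⊢
  intro ε hε
  obtain ⟨δ, hδ, H⟩ := hf ε hε
  refine ⟨δ, hδ, fun E hE hlen => ?_⟩
  convert! H E hE hlen using 1
  refine Finset.sum_congr rfl fun i hi => ?_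
  have h1 := hE.1 i hi
  rw [uIcc_of_le zero_le_one] at h1
  rw [h _ h1.1, h _ h1.2]

lemma AbsolutelyContinuousOnInterval.comp_contDiff {f F : ℝ → ℝ}
    (hf : AbsolutelyContinuousOnInterval f 0 1) (hF : ContDiff ℝ 1 F) :
    AbsolutelyContinuousOnInterval (fun x => F (f x)) 0 1 := by
  obtain ⟨C, hC⟩ := hf.exists_bound
  obtain ⟨K, hK⟩ := (hF.contDiffOn (s := Icc (-C) C)).exists_lipschitzOnWith (by decide)
    (convex_Icc _ _) isCompact_Icc
  rw [absolutelyContinuousOnInterval_iff] at hf ⊢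
  intro ε hε
  obtain ⟨δ, hδ, H⟩ := hf (ε / (K + 1)) (by positivity)
  refine ⟨δ, hδ, fun E hE hlen => ?_⟩
  have h2 := H E hE hlen
  rw [lt_div_iff₀ (by positivity)] at h2
  refine lt_of_le_of_lt ?_ h2
  rw [Finset.sum_mul]
  refine Finset.sum_le_sum fun i hi => ?_
  have h1 := hE.1 i hi
  have h3 := hK.dist_le_mul _ (abs_le.1 (hC _ h1.1)) _ (abs_le.1 (hC _ h1.2))
  have h4 : 0 ≤ dist (f (E.2 i).1) (f (E.2 i).2) := dist_nonneg
  linarith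

namespace IsPrim

variable {f f' g g' : ℝ → ℝ}

lemma absolutelyContinuous (h : IsPrim f f') : AbsolutelyContinuousOnInterval f 0 1 := by
  have hi := intervalIntegrable_of_Icc h.int (a := 0) (b := 1) (by simp) (by simp)
  have h1 := hi.absolutelyContinuousOnInterval_intervalIntegral (c := 0) (by simp)
  have h2 : AbsolutelyContinuousOnInterval (fun _ => f 0) 0 1 :=
    (contDiff_const (c := f 0) (𝕜 := ℝ) (E := ℝ) (n := 1)).contDiffOn.absolutelyContinuousOnInterval
  exact (h2.add h1).congr_Icc fun x hx => (h.ftc x hx).symm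

lemma continuousOn (h : IsPrim f f') : ContinuousOn f (Icc 0 1) := by
  simpa using h.absolutelyContinuous.continuousOn

lemma ae_hasDerivAt (h : IsPrim f f') :
    ∀ᵐ x, x ∈ Ioo (0:ℝ) 1 → HasDerivAt f (f' x) x := by
  have hi := intervalIntegrable_of_Icc h.int (a := 0) (b := 1) (by simp) (by simp)
  filter_upwards [hi.ae_hasDerivAt_integral] with x hx hx01
  have h1 := (hx (by rw [uIcc_of_le zero_le_one]; exact Ioo_subset_Icc_self hx01) 0
    (by simp)).const_add (f 0)
  refine h1.congr_of_eventuallyEq ?_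
  filter_upwards [Icc_mem_nhds hx01.1 hx01.2] with y hy using h.ftc y hy

lemma of_absolutelyContinuous (h : AbsolutelyContinuousOnInterval f 0 1)
    (hd : ∀ᵐ x, x ∈ Ioo (0:ℝ) 1 → HasDerivAt f (f' x) x) : IsPrim f f' := by
  have hi := h.intervalIntegrable_deriv
  have hne : ∀ᵐ x : ℝ, x ≠ 1 := by simp [ae_iff, measure_singleton]
  have hae : ∀ᵐ x, x ∈ Ioc (0:ℝ) 1 → deriv f x = f' x := by
    filter_upwards [hd, hne] with x hx hx1 h01
    exact (hx ⟨h01.1, lt_of_le_of_ne h01.2 hx1⟩).deriv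
  constructor
  · rw [integrableOn_Icc_iff_integrableOn_Ioc]
    rw [intervalIntegrable_iff, uIoc_of_le zero_le_one] at hi
    exact hi.congr ((ae_restrict_iff' measurableSet_Ioc).2 hae)
  · intro x hx
    have h1 : AbsolutelyContinuousOnInterval f 0 x := h.mono (by
      rw [uIcc_of_le hx.1, uIcc_of_le zero_le_one]; exact Icc_subset_Icc_right hx.2)
    have h2 := h1.integral_deriv_eq_sub
    have h3 : ∫ t in (0:ℝ)..x, f' t = ∫ t in (0:ℝ)..x, deriv f t := by
      refine intervalIntegral.integral_congr_ae ?_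
      filter_upwards [hae] with t ht ht'
      rw [uIoc_of_le hx.1] at ht'
      exact (ht ⟨ht'.1, ht'.2.trans hx.2⟩).symm
    rw [h3, h2]; ring

lemma mul (hf : IsPrim f f') (hg : IsPrim g g') :
    IsPrim (fun x => f x * g x) (fun x => f' x * g x + f x * g' x) := by
  refine of_absolutelyContinuous (hf.absolutelyContinuous.mul hg.absolutelyContinuous) ?_
  filter_upwards [hf.ae_hasDerivAt, hg.ae_hasDerivAt] with x h1 h2 hx
  exact (h1 hx).mul (h2 hx)

lemma comp {F F' : ℝ → ℝ} (hf : IsPrim f f') (hF : ContDiff ℝ 1 F)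
    (hF' : ∀ t, HasDerivAt F (F' t) t) :
    IsPrim (fun x => F (f x)) (fun x => F' (f x) * f' x) := by
  refine of_absolutelyContinuous (hf.absolutelyContinuous.comp_contDiff hF) ?_
  filter_upwards [hf.ae_hasDerivAt] with x h1 hx
  exact (hF' (f x)).comp x (h1 hx)

lemma of_integrableOn (hf : IntegrableOn f' (Icc (0:ℝ) 1)) (c : ℝ) :
    IsPrim (fun x => c + ∫ t in (0:ℝ)..x, f' t) f' :=
  ⟨hf, fun x _ => by simp⟩

lemma sub_eq_integral (hf : IsPrim f f') {a b : ℝ} (ha : a ∈ Icc (0:ℝ) 1)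
    (hb : b ∈ Icc (0:ℝ) 1) : f b - f a = ∫ t in a..b, f' t := by
  rw [hf.ftc a ha, hf.ftc b hb, add_sub_add_left_eq_sub,
    intervalIntegral.integral_interval_sub_left]
  · exact intervalIntegrable_of_Icc hf.int (by simp) hb
  · exact intervalIntegrable_of_Icc hf.int (by simp) ha

end IsPrim

/-- The weight `(1 + t²)^{5/4}` whose square is the denominator of the elastic energy density. -/
def wt (t : ℝ) : ℝ := (1 + t^2) ^ ((5:ℝ)/4)

lemma wt_pos (t : ℝ) : 0 < wt t := Real.rpow_pos_of_pos (by positivity) _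

lemma one_le_wt (t : ℝ) : 1 ≤ wt t :=
  Real.one_le_rpow (by nlinarith [sq_nonneg t]) (by norm_num)

lemma wt_sq (t : ℝ) : wt t ^ 2 = (1 + t^2) ^ ((5:ℝ)/2) := by
  rw [wt, ← Real.rpow_natCast, ← Real.rpow_mul (by positivity)]
  norm_num

lemma contDiff_wt : ContDiff ℝ 1 wt := by
  unfold wt
  exact ContDiff.rpow_const_of_ne (by fun_prop) fun x => by positivity

lemma continuous_wt : Continuous wt := contDiff_wt.continuous

lemma contDiff_inv_wt_sq : ContDiff ℝ 1 (fun t => (wt t ^ 2)⁻¹) :=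
  (contDiff_wt.pow 2).inv fun t => (pow_pos (wt_pos t) 2).ne'

lemma hasDerivAt_wt (t : ℝ) : HasDerivAt wt (deriv wt t) t :=
  (contDiff_wt.differentiable one_ne_zero t).hasDerivAt

lemma hasDerivAt_inv_wt_sq (t : ℝ) :
    HasDerivAt (fun t => (wt t ^ 2)⁻¹) (deriv (fun t => (wt t ^ 2)⁻¹) t) t :=
  (contDiff_inv_wt_sq.differentiable one_ne_zero t).hasDerivAt

lemma deriv_inv_wt_sq (t : ℝ) :
    deriv (fun t => (wt t ^ 2)⁻¹) t = -(2 * deriv wt t) / wt t ^ 3 := by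
  have h := ((hasDerivAt_wt t).pow 2).inv (pow_pos (wt_pos t) 2).ne'
  have h1 := h.deriv
  have := (wt_pos t).ne'
  calc _ = _ := h1
    _ = _ := by simp; field_simp

lemma inv_wt_sq_le_one (t : ℝ) : (wt t ^ 2)⁻¹ ≤ 1 :=
  inv_le_one_of_one_le₀ (one_le_pow₀ (one_le_wt t))

lemma graphE_eq (f : W22) :
    graphE f = ∫ x in Ioo (0:ℝ) 1, (f.ddu x)^2 * (wt (f.du x) ^ 2)⁻¹ := by
  unfold graphE
  simp only [wt_sq, div_eq_mul_inv]

lemma W22.isPrim_du (f : W22) : IsPrim f.du f.ddu := ⟨f.ddu_int, f.ftc_du⟩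

lemma W22.isPrim_u (f : W22) : IsPrim f.u f.du := ⟨f.du_int, f.ftc_u⟩

lemma integrable_mul_of_sq {μ : Measure ℝ} {a b : ℝ → ℝ} (ha : AEStronglyMeasurable a μ)
    (hb : AEStronglyMeasurable b μ) (ha2 : Integrable (fun x => a x ^ 2) μ)
    (hb2 : Integrable (fun x => b x ^ 2) μ) : Integrable (fun x => a x * b x) μ := by
  refine (ha2.add hb2).mono' (ha.mul hb) (Eventually.of_forall fun x => ?_)
  simp only [Real.norm_eq_abs, abs_mul, Pi.add_apply]
  nlinarith [sq_nonneg (|a x| - |b x|), sq_abs (a x), sq_abs (b x)]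

lemma integrable_add_sq {μ : Measure ℝ} {a b : ℝ → ℝ} (ha : AEStronglyMeasurable a μ)
    (hb : AEStronglyMeasurable b μ) (ha2 : Integrable (fun x => a x ^ 2) μ)
    (hb2 : Integrable (fun x => b x ^ 2) μ) : Integrable (fun x => (a x + b x) ^ 2) μ := by
  refine ((ha2.add ((integrable_mul_of_sq ha hb ha2 hb2).const_mul 2)).add hb2).congr
    (Eventually.of_forall fun x => ?_)
  simp only [Pi.add_apply]; ring

/-- The variation `u + ε ∫ θ` of a function of class `W^{2,2}`. -/
def W22.perturb (f : W22) {θ θ' : ℝ → ℝ} (hθ : IsPrim θ θ')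
    (hsq : IntegrableOn (fun x => θ' x ^ 2) (Icc (0:ℝ) 1)) (ε : ℝ) : W22 where
  u x := f.u x + ε * ∫ t in (0:ℝ)..x, θ t
  du x := f.du x + ε * θ x
  ddu x := f.ddu x + ε * θ' x
  du_int := f.du_int.add ((hθ.continuousOn.integrableOn_Icc).const_mul ε)
  ddu_int := f.ddu_int.add (hθ.int.const_mul ε)
  ddu_sq := by
    refine integrable_add_sq f.ddu_int.aestronglyMeasurable
      (hθ.int.const_mul ε).aestronglyMeasurable f.ddu_sq ?_
    simp only [mul_pow]
    exact hsq.const_mul _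
  ftc_u x hx := by
    have h0 : (0:ℝ) ∈ Icc (0:ℝ) 1 := by simp
    rw [intervalIntegral.integral_add (intervalIntegrable_of_Icc f.du_int h0 hx)
      (intervalIntegrable_of_Icc ((hθ.continuousOn.integrableOn_Icc).const_mul ε) h0 hx),
      intervalIntegral.integral_const_mul, f.ftc_u x hx]
    simp; ring
  ftc_du x hx := by
    have h0 : (0:ℝ) ∈ Icc (0:ℝ) 1 := by simp
    rw [intervalIntegral.integral_add (intervalIntegrable_of_Icc f.ddu_int h0 hx)
      (intervalIntegrable_of_Icc (hθ.int.const_mul ε) h0 hx),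
      intervalIntegral.integral_const_mul, f.ftc_du x hx, hθ.ftc x hx]
    ring

lemma hasDerivAt_graphE_perturb (f : W22) {θ θ' : ℝ → ℝ} (hθ : IsPrim θ θ')
    (hsq : IntegrableOn (fun x => θ' x ^ 2) (Icc (0:ℝ) 1)) :
    HasDerivAt (fun ε => graphE (f.perturb hθ hsq ε))
      (∫ x in Ioo (0:ℝ) 1, (2 * f.ddu x * θ' x * (wt (f.du x) ^ 2)⁻¹ +
        f.ddu x ^ 2 * (deriv (fun t => (wt t ^ 2)⁻¹) (f.du x) * θ x))) 0 := by
  obtain ⟨M₁, hM₁⟩ := isCompact_Icc.exists_bound_of_continuousOn f.isPrim_du.continuousOn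
  obtain ⟨M₂, hM₂⟩ := isCompact_Icc.exists_bound_of_continuousOn hθ.continuousOn
  have hqc : Continuous (deriv (fun t => (wt t ^ 2)⁻¹)) :=
    contDiff_inv_wt_sq.continuous_deriv le_rfl
  obtain ⟨C, hC⟩ := (isCompact_Icc (a := -(M₁ + M₂)) (b := M₁ + M₂)).exists_bound_of_continuousOn
    hqc.continuousOn
  have hμ : volume.restrict (Ioo (0:ℝ) 1) ≤ volume.restrict (Icc (0:ℝ) 1) :=
    Measure.restrict_mono Ioo_subset_Icc_self le_rfl
  have hdu : AEStronglyMeasurable f.du (volume.restrict (Ioo (0:ℝ) 1)) :=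
    f.du_int.aestronglyMeasurable.mono_measure hμ
  have hddu : AEStronglyMeasurable f.ddu (volume.restrict (Ioo (0:ℝ) 1)) :=
    f.ddu_int.aestronglyMeasurable.mono_measure hμ
  have hθm : AEStronglyMeasurable θ (volume.restrict (Ioo (0:ℝ) 1)) :=
    (hθ.continuousOn.integrableOn_Icc).aestronglyMeasurable.mono_measure hμ
  have hθ'm : AEStronglyMeasurable θ' (volume.restrict (Ioo (0:ℝ) 1)) :=
    hθ.int.aestronglyMeasurable.mono_measure hμ
  have hqm : ∀ ε : ℝ, AEStronglyMeasurable (fun x => (wt (f.du x + ε * θ x) ^ 2)⁻¹)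
      (volume.restrict (Ioo (0:ℝ) 1)) := fun ε =>
    contDiff_inv_wt_sq.continuous.comp_aestronglyMeasurable (hdu.add (hθm.const_mul ε))
  have hq'm : AEStronglyMeasurable (fun x => deriv (fun t => (wt t ^ 2)⁻¹) (f.du x))
      (volume.restrict (Ioo (0:ℝ) 1)) := hqc.comp_aestronglyMeasurable hdu
  have hFm : ∀ ε : ℝ, AEStronglyMeasurable
      (fun x => (f.ddu x + ε * θ' x) ^ 2 * (wt (f.du x + ε * θ x) ^ 2)⁻¹)
      (volume.restrict (Ioo (0:ℝ) 1)) := fun ε =>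
    ((hddu.add (hθ'm.const_mul ε)).pow 2).mul (hqm ε)
  have hb : Integrable (fun x => (3 + 2 * C * M₂) * (f.ddu x ^ 2 + θ' x ^ 2))
      (volume.restrict (Ioo (0:ℝ) 1)) :=
    Integrable.const_mul (((f.ddu_sq.add hsq).mono_set Ioo_subset_Icc_self)) _
  have key := hasDerivAt_integral_of_dominated_loc_of_deriv_le
    (μ := volume.restrict (Ioo (0:ℝ) 1)) (x₀ := (0:ℝ)) (s := Ioo (-1) 1)
    (F := fun ε x => (f.ddu x + ε * θ' x) ^ 2 * (wt (f.du x + ε * θ x) ^ 2)⁻¹)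
    (F' := fun ε x => 2 * (f.ddu x + ε * θ' x) * θ' x * (wt (f.du x + ε * θ x) ^ 2)⁻¹ +
        (f.ddu x + ε * θ' x) ^ 2 *
          (deriv (fun t => (wt t ^ 2)⁻¹) (f.du x + ε * θ x) * θ x))
    (bound := fun x => (3 + 2 * C * M₂) * (f.ddu x ^ 2 + θ' x ^ 2))
    (Ioo_mem_nhds (by norm_num) (by norm_num)) (Eventually.of_forall hFm) ?_ ?_ ?_ hb ?_
  · simp only [graphE_eq, W22.perturb]
    simpa only [zero_mul, add_zero] using key.2
  · refine Integrable.mono' (f.ddu_sq.mono_set Ioo_subset_Icc_self) (hFm 0)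
      (Eventually.of_forall fun x => ?_)
    simp only [zero_mul, add_zero]
    rw [Real.norm_of_nonneg (by have := wt_pos (f.du x); positivity)]
    exact mul_le_of_le_one_right (sq_nonneg _) (inv_wt_sq_le_one _)
  · simp only [zero_mul, add_zero]
    exact (((hddu.const_mul 2).mul hθ'm).mul (by simpa using hqm 0)).add
      ((hddu.pow 2).mul (hq'm.mul hθm))
  · refine (ae_restrict_iff' measurableSet_Ioo).2 (Eventually.of_forall fun x hx ε hε => ?_)
    have hx' := Ioo_subset_Icc_self hx
    have h1 : |f.du x| ≤ M₁ := hM₁ x hx'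
    have h2 : |θ x| ≤ M₂ := hM₂ x hx'
    have hε1 : |ε| ≤ 1 := abs_le.2 ⟨hε.1.le, hε.2.le⟩
    have h3 : |ε * θ x| ≤ M₂ := by
      rw [abs_mul]; nlinarith [abs_nonneg (θ x), abs_nonneg ε]
    have h4 : |deriv (fun t => (wt t ^ 2)⁻¹) (f.du x + ε * θ x)| ≤ C :=
      hC _ (abs_le.1 ((abs_add_le _ _).trans (add_le_add h1 h3)))
    set q' := deriv (fun t => (wt t ^ 2)⁻¹) (f.du x + ε * θ x)
    have h5 : |(wt (f.du x + ε * θ x) ^ 2)⁻¹| ≤ 1 := by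
      rw [abs_of_nonneg (by have := wt_pos (f.du x + ε * θ x); positivity)]
      exact inv_wt_sq_le_one _
    set q := (wt (f.du x + ε * θ x) ^ 2)⁻¹
    have h6 : |q' * θ x| ≤ C * M₂ := by
      rw [abs_mul]; exact mul_le_mul h4 h2 (abs_nonneg _) ((abs_nonneg _).trans h4)
    have h7 : |f.ddu x + ε * θ' x| ≤ |f.ddu x| + |θ' x| := by
      refine (abs_add_le _ _).trans (add_le_add le_rfl ?_)
      rw [abs_mul]; exact mul_le_of_le_one_left (abs_nonneg _) hε1
    have h8 : (f.ddu x + ε * θ' x) ^ 2 ≤ 2 * (f.ddu x ^ 2 + θ' x ^ 2) := by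
      rw [← sq_abs, ← sq_abs (f.ddu x), ← sq_abs (θ' x)]
      nlinarith [abs_nonneg (f.ddu x + ε * θ' x), sq_nonneg (|f.ddu x| - |θ' x|)]
    have h9 : |2 * (f.ddu x + ε * θ' x) * θ' x| ≤ 3 * (f.ddu x ^ 2 + θ' x ^ 2) := by
      rw [abs_mul, abs_mul, abs_two, ← sq_abs (f.ddu x), ← sq_abs (θ' x)]
      nlinarith [abs_nonneg (θ' x), sq_nonneg (|f.ddu x| - |θ' x|),
        mul_le_mul_of_nonneg_right h7 (abs_nonneg (θ' x)), sq_nonneg (f.ddu x)]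
    rw [Real.norm_eq_abs]
    refine (abs_add_le _ _).trans ?_
    rw [abs_mul, abs_mul ((f.ddu x + ε * θ' x) ^ 2),
      abs_of_nonneg (sq_nonneg (f.ddu x + ε * θ' x))]
    have h10 := mul_le_mul h9 h5 (abs_nonneg _) (by positivity)
    have h11 := mul_le_mul h8 h6 (abs_nonneg _) (by positivity)
    nlinarith
  · refine Eventually.of_forall fun x ε _ => ?_
    have e1 : HasDerivAt (fun ε : ℝ => f.ddu x + ε * θ' x) (θ' x) ε := by
      simpa using ((hasDerivAt_id ε).mul_const (θ' x)).const_add (f.ddu x)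
    have e2 : HasDerivAt (fun ε : ℝ => f.du x + ε * θ x) (θ x) ε := by
      simpa using ((hasDerivAt_id ε).mul_const (θ x)).const_add (f.du x)
    convert! (e1.pow 2).mul ((hasDerivAt_inv_wt_sq _).comp ε e2) using 1
    simp

lemma deriv_nonneg_of_right_min {g : ℝ → ℝ} {g' ε₀ : ℝ} (hg : HasDerivAt g g' 0) (hε₀ : 0 < ε₀)
    (h : ∀ ε ∈ Ioo 0 ε₀, g 0 ≤ g ε) : 0 ≤ g' := by
  have h1 := (hasDerivAt_iff_tendsto_slope.1 hg).mono_left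
    (nhdsWithin_mono 0 (fun x (hx : x ∈ Ioi (0:ℝ)) => (ne_of_gt hx : x ≠ 0)))
  refine ge_of_tendsto h1 ?_
  filter_upwards [Ioo_mem_nhdsGT hε₀] with ε hε
  rw [slope_def_field]
  exact div_nonneg (sub_nonneg.2 (h ε hε)) (by linarith [hε.1])

/-- First variation inequality for a minimizer of the obstacle problem, in the direction
`φ(x) = ∫₀ˣ η (1+u'²)^{5/4}`. -/
lemma first_variation {ψ : ℝ → ℝ} {f : W22} (hf : MemG ψ f)
    (hmin : ∀ v : W22, MemG ψ v → graphE f ≤ graphE v) {η η' : ℝ → ℝ} (hη : IsPrim η η')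
    (hsq : IntegrableOn (fun x => η' x ^ 2) (Icc (0:ℝ) 1))
    (h0 : ∫ x in (0:ℝ)..1, η x * wt (f.du x) = 0) {ε₀ : ℝ} (hε₀ : 0 < ε₀)
    (hadm : ∀ ε ∈ Ioo 0 ε₀, ∀ x ∈ Icc (0:ℝ) 1,
      ψ x ≤ f.u x + ε * ∫ t in (0:ℝ)..x, η t * wt (f.du t)) :
    0 ≤ ∫ x in Ioo (0:ℝ) 1, f.ddu x / wt (f.du x) * η' x := by
  have hw := f.isPrim_du.comp contDiff_wt hasDerivAt_wt
  have hθ := hη.mul hw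
  have hθsq : IntegrableOn (fun x => (η' x * wt (f.du x) +
      η x * (deriv wt (f.du x) * f.ddu x)) ^ 2) (Icc (0:ℝ) 1) := by
    have hc : ContinuousOn (fun x => deriv wt (f.du x)) (Icc 0 1) :=
      (contDiff_wt.continuous_deriv le_rfl).comp_continuousOn f.isPrim_du.continuousOn
    have a1 : AEStronglyMeasurable (fun x => η' x * wt (f.du x))
        (volume.restrict (Icc (0:ℝ) 1)) :=
      (hη.int.mul_continuousOn hw.continuousOn isCompact_Icc).aestronglyMeasurable
    have a2 : AEStronglyMeasurable (fun x => η x * (deriv wt (f.du x) * f.ddu x))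
        (volume.restrict (Icc (0:ℝ) 1)) :=
      (IntegrableOn.continuousOn_mul hη.continuousOn
        (f.ddu_int.continuousOn_mul hc isCompact_Icc) isCompact_Icc).aestronglyMeasurable
    refine integrable_add_sq a1 a2 ?_ ?_
    · simp only [mul_pow]
      exact hsq.mul_continuousOn (hw.continuousOn.pow 2) isCompact_Icc
    · simp only [mul_pow]
      exact IntegrableOn.continuousOn_mul (hη.continuousOn.pow 2)
        (f.ddu_sq.continuousOn_mul (hc.pow 2) isCompact_Icc) isCompact_Icc
  have hd := hasDerivAt_graphE_perturb f hθ hθsq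
  have hg0 : graphE (f.perturb hθ hθsq 0) = graphE f := by simp [graphE, W22.perturb]
  have h2 := deriv_nonneg_of_right_min hd hε₀ (fun ε hε => by
    rw [hg0]
    refine hmin _ ⟨?_, ?_, hadm ε hε⟩
    · simp [W22.perturb, hf.1]
    · simp [W22.perturb, hf.2.1, h0])
  have h3 : ∀ x, 2 * f.ddu x * (η' x * wt (f.du x) + η x * (deriv wt (f.du x) * f.ddu x)) *
      (wt (f.du x) ^ 2)⁻¹ + f.ddu x ^ 2 * (deriv (fun t => (wt t ^ 2)⁻¹) (f.du x) *
        (η x * wt (f.du x))) = 2 * (f.ddu x / wt (f.du x) * η' x) := by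
    intro x
    rw [deriv_inv_wt_sq]
    have := (wt_pos (f.du x)).ne'
    field_simp
    ring
  simp only [h3] at h2
  rw [integral_const_mul] at h2
  linarith

lemma integrableOn_comp_one_sub {g : ℝ → ℝ} (h : IntegrableOn g (Icc (0:ℝ) 1)) :
    IntegrableOn (fun x => g (1 - x)) (Icc (0:ℝ) 1) := by
  have h1 := ((intervalIntegrable_of_Icc h (a := 0) (b := 1) (by simp) (by simp)).comp_sub_left
    1).symm
  simp only [sub_self, sub_zero] at h1
  rwa [intervalIntegrable_iff_integrableOn_Icc_of_le zero_le_one] at h1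

namespace W22

lemma isPrim_wt_du (f : W22) :
    IsPrim (fun x => wt (f.du x)) (fun x => deriv wt (f.du x) * f.ddu x) :=
  f.isPrim_du.comp contDiff_wt hasDerivAt_wt

lemma intervalIntegrable_wt_du (f : W22) {a b : ℝ} (ha : a ∈ Icc (0:ℝ) 1)
    (hb : b ∈ Icc (0:ℝ) 1) : IntervalIntegrable (fun x => wt (f.du x)) volume a b :=
  intervalIntegrable_of_Icc f.isPrim_wt_du.continuousOn.integrableOn_Icc ha hb

lemma continuousOn_inv_wt_du (f : W22) : ContinuousOn (fun x => (wt (f.du x))⁻¹) (Icc 0 1) :=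
  f.isPrim_wt_du.continuousOn.inv₀ fun _ _ => (wt_pos _).ne'

lemma integrableOn_ddu_div (f : W22) :
    IntegrableOn (fun x => f.ddu x / wt (f.du x)) (Icc (0:ℝ) 1) :=
  f.ddu_int.mul_continuousOn f.continuousOn_inv_wt_du isCompact_Icc

lemma integrableOn_ddu_div_sq (f : W22) :
    IntegrableOn (fun x => (f.ddu x / wt (f.du x)) ^ 2) (Icc (0:ℝ) 1) := by
  simp only [div_eq_mul_inv, mul_pow]
  exact f.ddu_sq.mul_continuousOn (f.continuousOn_inv_wt_du.pow 2) isCompact_Icc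

/-- The reflected function `x ↦ u(1 - x)`. -/
def reflect (f : W22) : W22 where
  u x := f.u (1 - x)
  du x := -f.du (1 - x)
  ddu x := f.ddu (1 - x)
  du_int := (integrableOn_comp_one_sub f.du_int).neg
  ddu_int := integrableOn_comp_one_sub f.ddu_int
  ddu_sq := integrableOn_comp_one_sub f.ddu_sq
  ftc_u x hx := by
    have hx' : 1 - x ∈ Icc (0:ℝ) 1 := ⟨by linarith [hx.2], by linarith [hx.1]⟩
    have h := f.isPrim_u.sub_eq_integral hx' (b := 1) (by simp)
    rw [intervalIntegral.integral_neg, intervalIntegral.integral_comp_sub_left]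
    simp only [sub_zero]
    linarith
  ftc_du x hx := by
    have hx' : 1 - x ∈ Icc (0:ℝ) 1 := ⟨by linarith [hx.2], by linarith [hx.1]⟩
    have h := f.isPrim_du.sub_eq_integral hx' (b := 1) (by simp)
    rw [intervalIntegral.integral_comp_sub_left]
    simp only [sub_zero]
    linarith

lemma graphE_reflect (f : W22) : graphE f.reflect = graphE f := by
  simp only [graphE, reflect, neg_sq]
  rw [← integral_Ioc_eq_integral_Ioo, ← integral_Ioc_eq_integral_Ioo,
    ← intervalIntegral.integral_of_le zero_le_one, ← intervalIntegral.integral_of_le zero_le_one,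
    intervalIntegral.integral_comp_sub_left
      (fun x => f.ddu x ^ 2 / (1 + f.du x ^ 2) ^ ((5:ℝ)/2)) 1]
  simp

lemma memG_reflect {f : W22} {ψ : ℝ → ℝ} (hψ : ∀ x, ψ (1 - x) = ψ x) (hf : MemG ψ f) :
    MemG ψ f.reflect := by
  refine ⟨by simp [reflect, hf.2.1], by simp [reflect, hf.1], fun x hx => ?_⟩
  have := hf.2.2 (1 - x) ⟨by linarith [hx.2], by linarith [hx.1]⟩
  rwa [hψ] at this

end W22

/-- Minimizers of the obstacle problem are concave. -/
lemma antitoneOn_du_of_minimizer {ψ : ℝ → ℝ} {f : W22} (hf : MemG ψ f)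
    (hmin : ∀ v : W22, MemG ψ v → graphE f ≤ graphE v) : AntitoneOn f.du (Icc 0 1) := by
  have h0 : (0:ℝ) ∈ Icc (0:ℝ) 1 := by simp
  have h1 : (1:ℝ) ∈ Icc (0:ℝ) 1 := by simp
  set g : ℝ → ℝ := fun x => max (f.ddu x / wt (f.du x)) 0 with hg
  have hgint : IntegrableOn g (Icc (0:ℝ) 1) := f.integrableOn_ddu_div.pos_part
  have hg0 : ∀ x, 0 ≤ g x := fun x => le_max_right _ _
  have hgsq : IntegrableOn (fun x => g x ^ 2) (Icc (0:ℝ) 1) := by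
    refine f.integrableOn_ddu_div_sq.mono' (hgint.aestronglyMeasurable.pow 2)
      (Eventually.of_forall fun x => ?_)
    rw [Real.norm_of_nonneg (sq_nonneg _)]
    simp only [hg]
    rcases le_total (f.ddu x / wt (f.du x)) 0 with h | h
    · rw [max_eq_right h]; nlinarith [sq_nonneg (f.ddu x / wt (f.du x))]
    · rw [max_eq_left h]
  have hP : IsPrim (fun x => 0 + ∫ t in (0:ℝ)..x, g t) g := .of_integrableOn hgint 0
  have hWpos : 0 < ∫ x in (0:ℝ)..1, wt (f.du x) :=
    intervalIntegral.intervalIntegral_pos_of_pos (f.intervalIntegrable_wt_du h0 h1)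
      (fun x => wt_pos _) zero_lt_one
  set I := ∫ x in (0:ℝ)..1, (0 + ∫ t in (0:ℝ)..x, g t) * wt (f.du x) with hI
  set c := I / ∫ x in (0:ℝ)..1, wt (f.du x) with hc
  have hη : IsPrim (fun x => c + ∫ t in (0:ℝ)..x, -g t) (fun x => -g x) :=
    .of_integrableOn hgint.neg c
  set η : ℝ → ℝ := fun x => c + ∫ t in (0:ℝ)..x, -g t with hηdef
  have hηw : ∀ {a b : ℝ}, a ∈ Icc (0:ℝ) 1 → b ∈ Icc (0:ℝ) 1 →
      IntervalIntegrable (fun x => η x * wt (f.du x)) volume a b := fun ha hb =>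
    intervalIntegrable_of_Icc
      (hη.continuousOn.mul f.isPrim_wt_du.continuousOn).integrableOn_Icc ha hb
  have hzero : ∫ x in (0:ℝ)..1, η x * wt (f.du x) = 0 := by
    have e : ∀ x, η x * wt (f.du x) =
        c * wt (f.du x) - (0 + ∫ t in (0:ℝ)..x, g t) * wt (f.du x) := by
      intro x; simp only [hηdef, intervalIntegral.integral_neg]; ring
    simp only [e]
    have hJ : IntervalIntegrable (fun x => (0 + ∫ t in (0:ℝ)..x, g t) * wt (f.du x))
        volume 0 1 := intervalIntegrable_of_Icc
      (hP.continuousOn.mul f.isPrim_wt_du.continuousOn).integrableOn_Icc h0 h1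
    rw [intervalIntegral.integral_sub ((f.intervalIntegrable_wt_du h0 h1).const_mul c) hJ,
      intervalIntegral.integral_const_mul, ← hI, hc]
    field_simp
    simp
  have hanti : ∀ a ∈ Icc (0:ℝ) 1, ∀ b ∈ Icc (0:ℝ) 1, a ≤ b → η b ≤ η a := by
    intro a ha b hb hab
    have := hη.sub_eq_integral ha hb
    have h2 : 0 ≤ ∫ t in a..b, g t := intervalIntegral.integral_nonneg hab fun t _ => hg0 t
    rw [intervalIntegral.integral_neg] at this
    linarith
  have hφ : ∀ x ∈ Icc (0:ℝ) 1, 0 ≤ ∫ t in (0:ℝ)..x, η t * wt (f.du t) := by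
    intro x hx
    rcases le_total 0 (η x) with h | h
    · refine intervalIntegral.integral_nonneg hx.1 fun t ht => ?_
      exact mul_nonneg (h.trans (hanti t ⟨ht.1, ht.2.trans hx.2⟩ x hx ht.2)) (wt_pos _).le
    · have h3 := intervalIntegral.integral_add_adjacent_intervals (hηw h0 hx) (hηw hx h1)
      have h4 : 0 ≤ ∫ t in x..1, -(η t * wt (f.du t)) := by
        refine intervalIntegral.integral_nonneg hx.2 fun t ht => ?_
        have := (hanti x hx t ⟨hx.1.trans ht.1, ht.2⟩ ht.1).trans h
        nlinarith [wt_pos (f.du t)]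
      rw [intervalIntegral.integral_neg] at h4
      linarith
  have hvar := first_variation hf hmin hη (by simpa using hgsq) hzero zero_lt_one
    (fun ε hε x hx => by
      have := mul_nonneg hε.1.le (hφ x hx)
      linarith [hf.2.2 x hx])
  have e2 : ∀ x, f.ddu x / wt (f.du x) * -g x = -(g x ^ 2) := by
    intro x
    simp only [hg]
    rcases le_total (f.ddu x / wt (f.du x)) 0 with h | h
    · rw [max_eq_right h]; simp
    · rw [max_eq_left h]; ring
  simp only [e2, integral_neg] at hvar
  have hgsq' : IntegrableOn (fun x => g x ^ 2) (Ioo (0:ℝ) 1) := hgsq.mono_set Ioo_subset_Icc_self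
  have h5 : ∫ x in Ioo (0:ℝ) 1, g x ^ 2 = 0 :=
    le_antisymm (by linarith) (integral_nonneg fun x => sq_nonneg _)
  rw [setIntegral_eq_zero_iff_of_nonneg_ae (Eventually.of_forall fun x => sq_nonneg _) hgsq'] at h5
  have h6 : ∀ᵐ x, x ∈ Ioo (0:ℝ) 1 → f.ddu x ≤ 0 := by
    filter_upwards [(ae_restrict_iff' measurableSet_Ioo).1 h5] with x hx hx1
    have h7 : g x = 0 := by simpa using hx hx1
    have h8 : f.ddu x / wt (f.du x) ≤ 0 := h7 ▸ le_max_left _ _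
    by_contra! hneg
    exact absurd h8 (not_le.2 (div_pos hneg (wt_pos _)))
  intro a ha b hb hab
  have h9 := f.isPrim_du.sub_eq_integral ha hb
  have hne : ∀ᵐ x : ℝ, x ≠ 1 := by simp [ae_iff, measure_singleton]
  have h10 : ∫ t in a..b, f.ddu t ≤ 0 := by
    rw [intervalIntegral.integral_of_le hab]
    refine integral_nonpos_of_ae ((ae_restrict_iff' measurableSet_Ioc).2 ?_)
    filter_upwards [h6, hne] with x hx hx1 hx2
    exact hx ⟨ha.1.trans_lt hx2.1, lt_of_le_of_ne (hx2.2.trans hb.2) hx1⟩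
  linarith

lemma W22.two_mul_le_of_antitoneOn {f : W22} (hu : f.u 0 = 0) (h : AntitoneOn f.du (Icc 0 1))
    {x : ℝ} (hx : x ∈ Icc (0:ℝ) (1/2)) : 2 * x * f.u (1/2) ≤ f.u x := by
  have m0 : (0:ℝ) ∈ Icc (0:ℝ) 1 := by simp
  have mh : (1/2:ℝ) ∈ Icc (0:ℝ) 1 := by constructor <;> norm_num
  have mx : x ∈ Icc (0:ℝ) 1 := ⟨hx.1, by linarith [hx.2]⟩
  have e1 := f.isPrim_u.sub_eq_integral m0 mx
  have e2 := f.isPrim_u.sub_eq_integral mx mh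
  have i1 : ∫ t in (0:ℝ)..x, f.du x ≤ ∫ t in (0:ℝ)..x, f.du t :=
    intervalIntegral.integral_mono_on hx.1 intervalIntegrable_const
      (intervalIntegrable_of_Icc f.du_int m0 mx)
      fun t ht => h ⟨ht.1, ht.2.trans mx.2⟩ mx ht.2
  have i2 : ∫ t in x..(1/2:ℝ), f.du t ≤ ∫ t in x..(1/2:ℝ), f.du x :=
    intervalIntegral.integral_mono_on hx.2 (intervalIntegrable_of_Icc f.du_int mx mh)
      intervalIntegrable_const fun t ht => h mx ⟨hx.1.trans ht.1, ht.2.trans mh.2⟩ ht.1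
  rw [intervalIntegral.integral_const, smul_eq_mul] at i1 i2
  rw [← e1] at i1
  rw [← e2] at i2
  have := mul_le_mul_of_nonneg_left i2 hx.1
  have := mul_le_mul_of_nonneg_left i1 (sub_nonneg.2 hx.2)
  rw [hu] at *
  linarith

/-- Integrated Euler–Lagrange equation of a minimizer that lies strictly above the obstacle
on the left half of the interval. -/
lemma exists_du_eq_of_minimizer {ψ : ℝ → ℝ} {f : W22} (hf : MemG ψ f)
    (hmin : ∀ v : W22, MemG ψ v → graphE f ≤ graphE v) {κ : ℝ} (hκ : 0 < κ)
    (hb : ∀ x ∈ Icc (0:ℝ) (1/2), ψ x + κ * (1/2 - x) ≤ f.u x) :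
    ∃ l : ℝ, ∀ x ∈ Icc (0:ℝ) (1/2),
      f.du x = f.du 0 - l / 2 * (∫ t in (0:ℝ)..x, wt (f.du t)) ^ 2 := by
  have m0 : (0:ℝ) ∈ Icc (0:ℝ) 1 := by simp
  have m1 : (1:ℝ) ∈ Icc (0:ℝ) 1 := by simp
  have mh : (1/2:ℝ) ∈ Icc (0:ℝ) 1 := by constructor <;> norm_num
  have hsub : Icc (0:ℝ) (1/2) ⊆ Icc 0 1 := Icc_subset_Icc_right (by norm_num)
  have hwint : IntegrableOn (fun x => wt (f.du x)) (Icc (0:ℝ) 1) :=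
    f.isPrim_wt_du.continuousOn.integrableOn_Icc
  have hW : IsPrim (fun x => 0 + ∫ t in (0:ℝ)..x, wt (f.du t)) (fun x => wt (f.du x)) :=
    .of_integrableOn hwint 0
  set W : ℝ → ℝ := fun x => 0 + ∫ t in (0:ℝ)..x, wt (f.du t) with hWdef
  set r : ℝ → ℝ := fun x => f.ddu x / wt (f.du x) with hr
  have hW0 : W 0 = 0 := by simp [hWdef]
  have hI2 : 0 < ∫ x in (0:ℝ)..(1/2), W x ^ 2 := by
    refine intervalIntegral.intervalIntegral_pos_of_pos_on
      (intervalIntegrable_of_Icc (hW.continuousOn.pow 2).integrableOn_Icc m0 mh) (fun x hx => ?_)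
      (by norm_num)
    have : 0 < ∫ t in (0:ℝ)..x, wt (f.du t) :=
      intervalIntegral.intervalIntegral_pos_of_pos
        (f.intervalIntegrable_wt_du m0 (hsub (Ioo_subset_Icc_self hx))) (fun x => wt_pos _) hx.1
    simp only [hWdef, zero_add]
    positivity
  set l := -(∫ x in (0:ℝ)..(1/2), r x * W x) / ∫ x in (0:ℝ)..(1/2), W x ^ 2 with hl
  set k : ℝ → ℝ := fun x => r x + l * W x with hk
  have hlW : IntegrableOn (fun x => l * W x) (Icc (0:ℝ) 1) :=
    hW.continuousOn.integrableOn_Icc.const_mul l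
  have hkint : IntegrableOn k (Icc (0:ℝ) 1) := f.integrableOn_ddu_div.add hlW
  have hksq : IntegrableOn (fun x => k x ^ 2) (Icc (0:ℝ) 1) :=
    integrable_add_sq f.integrableOn_ddu_div.aestronglyMeasurable hlW.aestronglyMeasurable
      f.integrableOn_ddu_div_sq
      ((continuousOn_const.mul hW.continuousOn).pow 2).integrableOn_Icc
  set h : ℝ → ℝ := indicator {x | x ≤ 1/2} k with hh
  have hms : MeasurableSet {x : ℝ | x ≤ 1/2} := measurableSet_Iic
  have hhint : IntegrableOn h (Icc (0:ℝ) 1) := hkint.indicator hms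
  have hpos : ∀ {x}, x ≤ 1/2 → h x = k x := fun {x} hx => indicator_of_mem (by exact hx) _
  have hneg : ∀ {x}, 1/2 < x → h x = 0 := fun {x} hx => indicator_of_notMem (by simpa using hx) _
  have hhsq : IntegrableOn (fun x => h x ^ 2) (Icc (0:ℝ) 1) := by
    refine (hksq.indicator hms).congr (Eventually.of_forall fun x => ?_)
    rcases le_or_gt x (1/2) with hx | hx
    · simp only [indicator_of_mem (s := {x : ℝ | x ≤ 1/2}) hx, hpos hx]
    · rw [indicator_of_notMem (by simpa using hx)]; simp [hneg hx]
  have hhW : ∫ x in (0:ℝ)..1, h x * W x = 0 := by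
    have e : ∀ x, h x * W x = indicator {x | x ≤ 1/2} (fun x => r x * W x + l * W x ^ 2) x := by
      intro x
      rcases le_or_gt x (1/2) with hx | hx
      · rw [indicator_of_mem (by exact hx), hpos hx]; simp only [hk]; ring
      · rw [indicator_of_notMem (by simpa using hx), hneg hx]; simp
    simp only [e]
    have hrW : IntervalIntegrable (fun x => r x * W x) volume 0 (1/2) :=
      intervalIntegrable_of_Icc (f.integrableOn_ddu_div.mul_continuousOn hW.continuousOn
        isCompact_Icc) m0 mh
    have hlW2 : IntervalIntegrable (fun x => l * W x ^ 2) volume 0 (1/2) :=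
      intervalIntegrable_of_Icc (continuousOn_const.mul
        (hW.continuousOn.pow 2)).integrableOn_Icc m0 mh
    rw [intervalIntegral.integral_indicator mh, intervalIntegral.integral_add hrW hlW2,
      intervalIntegral.integral_const_mul, hl]
    field_simp
    ring
  have hη : IsPrim (fun x => (∫ t in (0:ℝ)..1, h t) + ∫ t in (0:ℝ)..x, -h t) (fun x => -h x) :=
    .of_integrableOn hhint.neg _
  set η : ℝ → ℝ := fun x => (∫ t in (0:ℝ)..1, h t) + ∫ t in (0:ℝ)..x, -h t with hηdef
  have hη1 : η 1 = 0 := by simp [hηdef]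
  have hηright : ∀ x ∈ Icc (1/2:ℝ) 1, η x = 0 := by
    intro x hx
    have e := hη.sub_eq_integral (a := x) ⟨by linarith [hx.1], hx.2⟩ m1
    rw [intervalIntegral.integral_zero_ae (Eventually.of_forall fun t ht => by
      rw [uIoc_of_le hx.2] at ht
      rw [hneg (hx.1.trans_lt ht.1), neg_zero])] at e
    linarith
  have hηw : ∀ {a b : ℝ}, a ∈ Icc (0:ℝ) 1 → b ∈ Icc (0:ℝ) 1 →
      IntervalIntegrable (fun x => η x * wt (f.du x)) volume a b := fun ha hb =>
    intervalIntegrable_of_Icc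
      (hη.continuousOn.mul f.isPrim_wt_du.continuousOn).integrableOn_Icc ha hb
  have hzero : ∫ x in (0:ℝ)..1, η x * wt (f.du x) = 0 := by
    have e := (hη.mul hW).sub_eq_integral m0 m1
    have hhW' : IntervalIntegrable (fun x => -h x * W x) volume 0 1 :=
      intervalIntegrable_of_Icc (IntegrableOn.mul_continuousOn hhint.neg hW.continuousOn
        isCompact_Icc) m0 m1
    rw [intervalIntegral.integral_add hhW' (hηw m0 m1)] at e
    simp only [neg_mul, intervalIntegral.integral_neg, hhW, hη1, hW0] at e
    linarith
  obtain ⟨M, hM⟩ := isCompact_Icc.exists_bound_of_continuousOn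
    (hη.continuousOn.mul f.isPrim_wt_du.continuousOn)
  have hM0 : 0 ≤ M := (norm_nonneg _).trans (hM 0 m0)
  have hφright : ∀ x ∈ Icc (1/2:ℝ) 1, ∫ t in (0:ℝ)..x, η t * wt (f.du t) = 0 := by
    intro x hx
    have mx : x ∈ Icc (0:ℝ) 1 := ⟨by linarith [hx.1], hx.2⟩
    have e := intervalIntegral.integral_add_adjacent_intervals (hηw m0 mx) (hηw mx m1)
    rw [intervalIntegral.integral_zero_ae (a := x) (Eventually.of_forall fun t ht => by
      rw [uIoc_of_le hx.2] at ht
      rw [hηright t ⟨hx.1.trans ht.1.le, ht.2⟩, zero_mul])] at e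
    linarith
  have hφleft : ∀ x ∈ Icc (0:ℝ) (1/2),
      -(M * (1/2 - x)) ≤ ∫ t in (0:ℝ)..x, η t * wt (f.du t) := by
    intro x hx
    have e := intervalIntegral.integral_add_adjacent_intervals (hηw m0 (hsub hx))
      (hηw (hsub hx) mh)
    rw [hφright _ ⟨le_rfl, mh.2⟩] at e
    have e2 := intervalIntegral.norm_integral_le_of_norm_le_const (a := x) (b := 1/2)
      (f := fun t => η t * wt (f.du t)) (C := M) fun t ht => by
        rw [uIoc_of_le hx.2] at ht
        exact hM t ⟨hx.1.trans ht.1.le, ht.2.trans mh.2⟩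
    rw [abs_of_nonneg (sub_nonneg.2 hx.2)] at e2
    linarith [(abs_le.1 e2).2]
  have hvar := first_variation hf hmin hη (by simpa using hhsq) hzero
    (ε₀ := κ / (M + 1)) (by positivity) (fun ε hε x hx => by
      rcases le_or_gt x (1/2) with hx2 | hx2
      · have hεM : ε * M ≤ κ := by
          have := (lt_div_iff₀ (by positivity)).1 hε.2
          nlinarith [hε.1]
        have h1 := mul_le_mul_of_nonneg_left (hφleft x ⟨hx.1, hx2⟩) hε.1.le
        have h2 := mul_le_mul_of_nonneg_right hεM (sub_nonneg.2 hx2)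
        have h3 := hb x ⟨hx.1, hx2⟩
        linarith
      · rw [hφright x ⟨hx2.le, hx.2⟩]
        linarith [hf.2.2 x hx])
  have e2 : ∀ x, f.ddu x / wt (f.du x) * -h x = l * (h x * W x) - h x ^ 2 := by
    intro x
    rcases le_or_gt x (1/2) with hx | hx
    · rw [hpos hx]; simp only [hk, hr]; ring
    · rw [hneg hx]; simp
  have hhWint : IntegrableOn (fun x => l * (h x * W x)) (Ioo (0:ℝ) 1) :=
    Integrable.const_mul ((hhint.mul_continuousOn hW.continuousOn isCompact_Icc).mono_set
      Ioo_subset_Icc_self) l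
  have hhsq' : IntegrableOn (fun x => h x ^ 2) (Ioo (0:ℝ) 1) := hhsq.mono_set Ioo_subset_Icc_self
  rw [intervalIntegral.integral_of_le zero_le_one, integral_Ioc_eq_integral_Ioo] at hhW
  simp only [e2] at hvar
  rw [integral_sub hhWint hhsq', integral_const_mul, hhW] at hvar
  have h5 : ∫ x in Ioo (0:ℝ) 1, h x ^ 2 = 0 :=
    le_antisymm (by linarith) (integral_nonneg fun x => sq_nonneg _)
  rw [setIntegral_eq_zero_iff_of_nonneg_ae (Eventually.of_forall fun x => sq_nonneg _) hhsq'] at h5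
  refine ⟨l, fun x hx => ?_⟩
  have e3 := f.isPrim_du.sub_eq_integral m0 (hsub hx)
  have e4 := (hW.mul hW).sub_eq_integral m0 (hsub hx)
  have e5 : ∫ t in (0:ℝ)..x, f.ddu t =
      ∫ t in (0:ℝ)..x, -(l / 2) * (wt (f.du t) * W t + W t * wt (f.du t)) := by
    refine intervalIntegral.integral_congr_ae ?_
    filter_upwards [(ae_restrict_iff' measurableSet_Ioo).1 h5] with t ht htx
    rw [uIoc_of_le hx.1] at htx
    have ht2 : t ≤ 1/2 := htx.2.trans hx.2
    have h7 : h t = 0 := by simpa using ht ⟨htx.1, by linarith⟩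
    rw [hpos ht2] at h7
    simp only [hk, hr] at h7
    have := (wt_pos (f.du t)).ne'
    field_simp at h7
    linarith
  rw [intervalIntegral.integral_const_mul, ← e4, hW0] at e5
  have e6 : W x = ∫ t in (0:ℝ)..x, wt (f.du t) := zero_add _
  rw [← e6]
  linarith

lemma ratio_eq (B : ℝ) : ratio B = (∫ t in (0:ℝ)..B, t / (√(B - t) * wt t)) /
    (2 * ∫ t in (0:ℝ)..B, 1 / (√(B - t) * wt t)) := rfl

lemma exists_le_ratio {f : W22} {A l : ℝ} (hA : 0 < A) (hu : f.u 0 = 0) (huA : A ≤ f.u (1/2))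
    (hdu : f.du (1/2) ≤ 0) (hl : ∀ x ∈ Icc (0:ℝ) (1/2),
      f.du x = f.du 0 - l / 2 * (∫ t in (0:ℝ)..x, wt (f.du t)) ^ 2) :
    ∃ B > 0, A ≤ ratio B := by
  have m0 : (0:ℝ) ∈ Icc (0:ℝ) 1 := by simp
  have mh : (1/2:ℝ) ∈ Icc (0:ℝ) 1 := by constructor <;> norm_num
  have hsub : Icc (0:ℝ) (1/2) ⊆ Icc 0 1 := Icc_subset_Icc_right (by norm_num)
  set W : ℝ → ℝ := fun x => ∫ t in (0:ℝ)..x, wt (f.du t) with hWdef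
  have hl' : ∀ x ∈ Icc (0:ℝ) (1/2), f.du x = f.du 0 - l / 2 * W x ^ 2 := hl
  have hWmono : ∀ x ∈ Icc (0:ℝ) (1/2), ∀ y ∈ Icc (0:ℝ) (1/2), x < y → W x < W y := by
    intro x hx y hy hxy
    have h1 := intervalIntegral.integral_add_adjacent_intervals
      (f.intervalIntegrable_wt_du m0 (hsub hx)) (f.intervalIntegrable_wt_du (hsub hx) (hsub hy))
    have h2 := intervalIntegral.intervalIntegral_pos_of_pos
      (f.intervalIntegrable_wt_du (hsub hx) (hsub hy)) (fun _ => wt_pos _) hxy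
    simp only [hWdef]
    linarith
  have hW0 : W 0 = 0 := by simp [hWdef]
  have hWpos : ∀ x ∈ Icc (0:ℝ) (1/2), 0 < x → 0 < W x := fun x hx h =>
    hW0 ▸ hWmono 0 ⟨le_rfl, by norm_num⟩ x hx h
  have hWnn : ∀ x ∈ Icc (0:ℝ) (1/2), 0 ≤ W x := fun x hx => by
    rcases hx.1.eq_or_lt with h | h
    · rw [← h, hW0]
    · exact (hWpos x hx h).le
  have hWsq : ∀ x ∈ Icc (0:ℝ) (1/2), ∀ y ∈ Icc (0:ℝ) (1/2), x < y → W x ^ 2 < W y ^ 2 :=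
    fun x hx y hy hxy => pow_lt_pow_left₀ (hWmono x hx y hy hxy) (hWnn x hx) two_ne_zero
  have huh : f.u (1/2) = ∫ t in (0:ℝ)..(1/2), f.du t := by
    rw [f.ftc_u _ mh, hu, zero_add]
  have hnot : ¬ ∀ x ∈ Icc (0:ℝ) (1/2), f.du x ≤ 0 := fun h => by
    have h1 : 0 ≤ ∫ t in (0:ℝ)..(1/2), -f.du t :=
      intervalIntegral.integral_nonneg (by norm_num) fun t ht => neg_nonneg.2 (h t ht)
    rw [intervalIntegral.integral_neg] at h1
    linarith
  have hlpos : 0 < l := by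
    by_contra! hle
    refine hnot fun x hx => ?_
    have h1 := hl' x hx
    have h2 := hl' (1/2) ⟨by norm_num, le_rfl⟩
    have h3 : W x ^ 2 ≤ W (1/2) ^ 2 := by
      rcases hx.2.eq_or_lt with h | h
      · rw [h]
      · exact (hWsq x hx _ ⟨by norm_num, le_rfl⟩ h).le
    nlinarith
  set B := f.du 0 with hB
  have hBpos : 0 < B := by
    by_contra! hle
    refine hnot fun x hx => ?_
    have h1 := hl' x hx
    have h2 : 0 ≤ l / 2 * W x ^ 2 := by positivity
    linarith
  obtain ⟨y, hy, hy0⟩ : (0:ℝ) ∈ f.du '' Icc 0 (1/2) :=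
    intermediate_value_Icc' (by norm_num) (f.isPrim_du.continuousOn.mono hsub) ⟨hdu, hBpos.le⟩
  have hypos : 0 < y := hy.1.lt_of_ne fun h => by
    rw [← h] at hy0
    linarith
  have hsub2 : Icc 0 y ⊆ Icc (0:ℝ) (1/2) := Icc_subset_Icc_right hy.2
  have hanti : StrictAntiOn f.du (Icc 0 (1/2)) := fun a ha b hb hab => by
    rw [hl' a ha, hl' b hb]
    have := mul_lt_mul_of_pos_left (hWsq a ha b hb hab) (half_pos hlpos)
    linarith
  have himage : f.du '' Ioo 0 y = Ioo 0 B := by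
    apply Subset.antisymm
    · rintro _ ⟨x, hx, rfl⟩
      have hx' := hsub2 (Ioo_subset_Icc_self hx)
      exact ⟨hy0 ▸ hanti hx' hy hx.2, hanti ⟨le_rfl, by norm_num⟩ hx' hx.1⟩
    · have := intermediate_value_Ioo' hypos.le (f.isPrim_du.continuousOn.mono (hsub2.trans hsub))
      rwa [hy0] at this
  have hderiv : ∀ x ∈ Ioo 0 y, HasDerivWithinAt f.du (-(l * W x * wt (f.du x))) (Ioo 0 y) x := by
    intro x hx
    have hxh : x ∈ Ioo (0:ℝ) (1/2) := ⟨hx.1, hx.2.trans_le hy.2⟩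
    have hx1 : x ∈ Ioo (0:ℝ) 1 := ⟨hx.1, by linarith [hxh.2]⟩
    have hc := f.isPrim_wt_du.continuousOn
    have h1 : HasDerivAt W (wt (f.du x)) x :=
      intervalIntegral.integral_hasDerivAt_right
        (f.intervalIntegrable_wt_du m0 (Ioo_subset_Icc_self hx1))
        ((hc.mono Ioo_subset_Icc_self).stronglyMeasurableAtFilter isOpen_Ioo x hx1)
        (hc.continuousAt (Icc_mem_nhds hx1.1 hx1.2))
    have h2 : HasDerivAt (fun x => B - l / 2 * W x ^ 2) (-(l * W x * wt (f.du x))) x := by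
      convert! ((h1.pow 2).const_mul (l / 2)).const_sub B using 1
      simp only [Nat.cast_ofNat, Nat.add_one_sub_one, pow_one]
      ring
    refine (h2.congr_of_eventuallyEq ?_).hasDerivWithinAt
    filter_upwards [Icc_mem_nhds hxh.1 hxh.2] with z hz using hl' z hz
  have hsqrt : ∀ x ∈ Ioo 0 y, √(B - f.du x) = √(l / 2) * W x := by
    intro x hx
    have hx' := hsub2 (Ioo_subset_Icc_self hx)
    rw [hl' x hx', sub_sub_cancel, Real.sqrt_mul (by positivity), Real.sqrt_sq (hWnn x hx')]
  have hc : 0 < √(l / 2) := Real.sqrt_pos.2 (by positivity)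
  have change : ∀ p : ℝ → ℝ, ∫ t in (0:ℝ)..B, p t / (√(B - t) * wt t) =
      l / √(l / 2) * ∫ x in (0:ℝ)..y, p (f.du x) := by
    intro p
    rw [intervalIntegral.integral_of_le hBpos.le, integral_Ioc_eq_integral_Ioo, ← himage,
      integral_image_eq_integral_deriv_smul_of_antitoneOn measurableSet_Ioo hderiv
        (hanti.antitoneOn.mono (Ioo_subset_Icc_self.trans hsub2)),
      intervalIntegral.integral_of_le hypos.le, integral_Ioc_eq_integral_Ioo,
      ← integral_const_mul]
    refine setIntegral_congr_fun measurableSet_Ioo fun x hx => ?_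
    have h1 := hWpos x (hsub2 (Ioo_subset_Icc_self hx)) hx.1
    have h2 := wt_pos (f.du x)
    simp only [hsqrt x hx, neg_neg, smul_eq_mul]
    field_simp
  have hN := change fun t => t
  have hD := change fun _ => 1
  rw [intervalIntegral.integral_const, smul_eq_mul, mul_one, sub_zero] at hD
  have huy : ∫ x in (0:ℝ)..y, f.du x = f.u y := by
    rw [f.ftc_u y (hsub hy), hu, zero_add]
  have hAy : A ≤ f.u y := by
    have h1 := f.isPrim_u.sub_eq_integral (hsub hy) mh
    have h2 : 0 ≤ ∫ t in y..(1/2), -f.du t :=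
      intervalIntegral.integral_nonneg hy.2 fun t ht => neg_nonneg.2
        (hy0 ▸ hanti.antitoneOn hy ⟨hy.1.trans ht.1, ht.2⟩ ht.1)
    rw [intervalIntegral.integral_neg] at h2
    linarith
  refine ⟨B, hBpos, ?_⟩
  rw [ratio_eq, hN, hD, huy]
  have : l / √(l / 2) * f.u y / (2 * (l / √(l / 2) * y)) = f.u y / (2 * y) := by
    field_simp
  rw [this, le_div_iff₀ (by positivity)]
  nlinarith [hy.2]

lemma hasDerivAt_neg_two_mul_sqrt_sub {B t : ℝ} (h : t < B) :
    HasDerivAt (fun t => -(2 * √(B - t))) (√(B - t))⁻¹ t := by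
  have h1 : HasDerivAt (fun t => B - t) (-1) t := by
    simpa using (hasDerivAt_id t).const_sub B
  convert! ((h1.sqrt (sub_pos.2 h).ne').const_mul 2).neg using 1
  have := Real.sqrt_pos.2 (sub_pos.2 h)
  field_simp

lemma continuous_neg_two_mul_sqrt_sub (B : ℝ) : Continuous fun t => -(2 * √(B - t)) := by
  fun_prop

lemma intervalIntegrable_inv_sqrt_sub {B : ℝ} (hB : 0 ≤ B) :
    IntervalIntegrable (fun t => (√(B - t))⁻¹) volume 0 B := by
  refine intervalIntegral.intervalIntegrable_deriv_of_nonneg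
    (continuous_neg_two_mul_sqrt_sub B).continuousOn (fun t ht => ?_)
    fun t _ => inv_nonneg.2 (Real.sqrt_nonneg _)
  rw [max_eq_right hB] at ht
  exact hasDerivAt_neg_two_mul_sqrt_sub ht.2

lemma integral_inv_sqrt_sub {B : ℝ} (hB : 0 ≤ B) :
    ∫ t in (0:ℝ)..B, (√(B - t))⁻¹ = 2 * √B := by
  rw [intervalIntegral.integral_eq_sub_of_hasDerivAt_of_le hB
    (continuous_neg_two_mul_sqrt_sub B).continuousOn
    (fun t ht => hasDerivAt_neg_two_mul_sqrt_sub ht.2) (intervalIntegrable_inv_sqrt_sub hB)]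
  simp

lemma continuous_id_div_wt : Continuous fun t => t / wt t :=
  continuous_id.div continuous_wt fun t => (wt_pos t).ne'

lemma integral_id_div_wt_le (B : ℝ) : ∫ t in (0:ℝ)..B, t / wt t ≤ 2 := by
  have h : ∀ t : ℝ, HasDerivAt (fun t : ℝ => -2 * (1 + t^2) ^ (-(1:ℝ)/4)) (t / wt t) t := by
    intro t
    have h1 : HasDerivAt (fun t : ℝ => 1 + t^2) (2 * t) t := by
      simpa using (hasDerivAt_pow 2 t).const_add 1
    have hp : 0 < 1 + t^2 := by positivity
    convert! (h1.rpow_const (p := -(1:ℝ)/4) (Or.inl hp.ne')).const_mul (-2) using 1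
    rw [wt, div_eq_mul_inv, ← Real.rpow_neg hp.le]
    norm_num
    ring
  rw [intervalIntegral.integral_eq_sub_of_hasDerivAt (fun t _ => h t)
    (continuous_id_div_wt.intervalIntegrable _ _)]
  have : 0 ≤ (1 + B^2) ^ (-(1:ℝ)/4) := by positivity
  norm_num
  norm_num at this
  linarith

lemma id_div_wt_mul_inv_sqrt_le {B t : ℝ} (hB : 0 < B) (ht : t ∈ Icc 0 B) :
    t / (√(B - t) * wt t) ≤ 2 / √B * (t / wt t) + 2 / B * (√(B - t))⁻¹ := by
  have hw := wt_pos t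
  have hsB := Real.sqrt_pos.2 hB
  have hq : 0 ≤ t / wt t := div_nonneg ht.1 hw.le
  have e : t / (√(B - t) * wt t) = (√(B - t))⁻¹ * (t / wt t) := by
    rw [div_mul_eq_div_div_swap, div_eq_inv_mul]
  rw [e]
  rcases le_total t (B/2) with h | h
  · have h1 : √B / 2 ≤ √(B - t) := by
      refine Real.le_sqrt_of_sq_le ?_
      rw [div_pow, Real.sq_sqrt hB.le]
      linarith
    have h2 : (√(B - t))⁻¹ ≤ 2 / √B := by
      rw [← inv_div]
      exact inv_anti₀ (by positivity) h1
    have h3 : 0 ≤ 2 / B * (√(B - t))⁻¹ := by positivity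
    linarith [mul_le_mul_of_nonneg_right h2 hq]
  · have h1 : 1 + t^2 ≤ wt t := by
      rw [wt]
      exact Real.self_le_rpow_of_one_le (by nlinarith [sq_nonneg t]) (by norm_num)
    have h2 : t / wt t ≤ 2 / B := by
      rw [div_le_div_iff₀ hw hB]
      nlinarith
    have h3 : 0 ≤ 2 / √B * (t / wt t) := by positivity
    linarith [mul_le_mul_of_nonneg_left h2 (inv_nonneg.2 (Real.sqrt_nonneg (B - t)))]

lemma wt_le_wt_one {t : ℝ} (ht : t ∈ Icc (0:ℝ) 1) : wt t ≤ wt 1 :=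
  Real.rpow_le_rpow (by positivity) (by nlinarith [ht.1, ht.2]) (by norm_num)

lemma bddAbove_ratio : BddAbove (ratio '' Ioi 0) := by
  refine ⟨4 * wt 1, ?_⟩
  rintro _ ⟨B, hB, rfl⟩
  have hB : 0 < B := hB
  have hw1 := one_le_wt 1
  have hsB := Real.sqrt_pos.2 hB
  have hiN : IntervalIntegrable (fun t => t / (√(B - t) * wt t)) volume 0 B := by
    refine ((intervalIntegrable_inv_sqrt_sub hB.le).mul_continuousOn
      continuous_id_div_wt.continuousOn).congr fun t _ => ?_
    simp only [div_mul_eq_div_div_swap t]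
    rw [div_eq_inv_mul (t / wt t)]
  have hiD : IntervalIntegrable (fun t => 1 / (√(B - t) * wt t)) volume 0 B := by
    refine ((intervalIntegrable_inv_sqrt_sub hB.le).mul_continuousOn
      (continuous_wt.inv₀ fun t => (wt_pos t).ne').continuousOn).congr fun t _ => ?_
    simp only [one_div, mul_inv, Pi.inv_apply]
  have hDnn : ∀ t : ℝ, 0 ≤ 1 / (√(B - t) * wt t) := fun t => by
    have := wt_pos t
    positivity
  have hD0 : 0 ≤ ∫ t in (0:ℝ)..B, 1 / (√(B - t) * wt t) :=
    intervalIntegral.integral_nonneg hB.le fun t _ => hDnn t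
  rw [ratio_eq]
  refine div_le_of_le_mul₀ (by positivity) (by positivity) ?_
  rcases le_total B 1 with h1 | h1
  · have h2 : ∫ t in (0:ℝ)..B, t / (√(B - t) * wt t) ≤
        ∫ t in (0:ℝ)..B, 1 / (√(B - t) * wt t) := by
      refine intervalIntegral.integral_mono_on hB.le hiN hiD fun t ht => ?_
      have := wt_pos t
      exact div_le_div_of_nonneg_right (ht.2.trans h1) (by positivity)
    nlinarith
  · have hN : ∫ t in (0:ℝ)..B, t / (√(B - t) * wt t) ≤ 8 / √B := by
      have i1 : IntervalIntegrable (fun t => 2 / √B * (t / wt t)) volume 0 B :=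
        (continuous_id_div_wt.intervalIntegrable _ _).const_mul _
      have i2 := (intervalIntegrable_inv_sqrt_sub hB.le).const_mul (2 / B)
      have h2 := intervalIntegral.integral_mono_on hB.le hiN (i1.add i2) fun t ht =>
        id_div_wt_mul_inv_sqrt_le hB ht
      rw [intervalIntegral.integral_add i1 i2, intervalIntegral.integral_const_mul,
        intervalIntegral.integral_const_mul, integral_inv_sqrt_sub hB.le] at h2
      have h3 := mul_le_mul_of_nonneg_left (integral_id_div_wt_le B)
        (show 0 ≤ 2 / √B by positivity)
      have h4 : 2 / B * (2 * √B) = 4 / √B := by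
        have := Real.sq_sqrt hB.le
        field_simp
        linarith
      have h5 : 8 / √B = 2 / √B * 2 + 4 / √B := by ring
      linarith
    have hD : 1 / (√B * wt 1) ≤ ∫ t in (0:ℝ)..B, 1 / (√(B - t) * wt t) := by
      have i1 : IntervalIntegrable (fun t => 1 / (√(B - t) * wt t)) volume 0 1 :=
        hiD.mono_set (by
          rw [uIcc_of_le zero_le_one, uIcc_of_le hB.le]; exact Icc_subset_Icc_right h1)
      have i2 : IntervalIntegrable (fun t => 1 / (√(B - t) * wt t)) volume 1 B :=
        hiD.mono_set (by
          rw [uIcc_of_le h1, uIcc_of_le hB.le]; exact Icc_subset_Icc_left zero_le_one)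
      rw [← intervalIntegral.integral_add_adjacent_intervals i1 i2]
      have h2 : 0 ≤ ∫ t in (1:ℝ)..B, 1 / (√(B - t) * wt t) :=
        intervalIntegral.integral_nonneg h1 fun t _ => hDnn t
      have h3 : ∫ t in (0:ℝ)..1, 1 / (√B * wt 1) ≤ ∫ t in (0:ℝ)..1, 1 / (√(B - t) * wt t) := by
        refine intervalIntegral.integral_mono_on_of_le_Ioo zero_le_one intervalIntegrable_const i1
          fun t ht => ?_
        have hBt : 0 < √(B - t) := Real.sqrt_pos.2 (by linarith [ht.2])
        have hw := wt_pos t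
        refine one_div_le_one_div_of_le (by positivity) ?_
        exact mul_le_mul (Real.sqrt_le_sqrt (by linarith [ht.1]))
          (wt_le_wt_one (Ioo_subset_Icc_self ht)) hw.le hsB.le
      rw [intervalIntegral.integral_const, sub_zero, one_smul] at h3
      linarith
    calc ∫ t in (0:ℝ)..B, t / (√(B - t) * wt t) ≤ 8 / √B := hN
      _ = 4 * wt 1 * (2 * (1 / (√B * wt 1))) := by field_simp; norm_num
      _ ≤ _ := by gcongr

lemma coneObstacle_one_sub (A s x : ℝ) : coneObstacle A s (1 - x) = coneObstacle A s x := by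
  unfold coneObstacle
  split_ifs with h1 h2 h2
  · have : x = 1/2 := by linarith
    subst this
    ring
  · ring
  · ring
  · linarith

lemma coneObstacle_le {A s x : ℝ} (hA : 0 < A) (hs : s < 1/2) : coneObstacle A s x ≤ A := by
  have h : 0 < 1/2 - s := by linarith
  have hk : 0 < A / (1/2 - s) := by positivity
  have e : A / (1/2 - s) * (1/2 - s) = A := div_mul_cancel₀ _ h.ne'
  unfold coneObstacle
  split_ifs with h1 <;> nlinarith

lemma coneObstacle_half {A s : ℝ} (hs : s < 1/2) : coneObstacle A s (1/2) = A := by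
  have h : 1/2 - s ≠ 0 := by linarith
  rw [coneObstacle, if_pos le_rfl, div_mul_cancel₀ _ h]

/-- A concave function above the cone lies strictly above it on the left half, away from the
tip. -/
lemma coneObstacle_add_le {A s : ℝ} (hs : s < 1/2) {f : W22}
    (hf : MemG (coneObstacle A s) f) (h : AntitoneOn f.du (Icc 0 1)) {x : ℝ}
    (hx : x ∈ Icc (0:ℝ) (1/2)) :
    coneObstacle A s x + 2 * (A / (1/2 - s)) * s * (1/2 - x) ≤ f.u x := by
  have h1 := W22.two_mul_le_of_antitoneOn hf.1 h hx
  have h2 := hf.2.2 (1/2) ⟨by norm_num, by norm_num⟩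
  rw [coneObstacle_half hs] at h2
  have h3 : 1/2 - s ≠ 0 := by linarith
  have e : A / (1/2 - s) * (1/2 - s) = A := div_mul_cancel₀ _ h3
  rw [coneObstacle, if_pos hx.2]
  nlinarith [hx.1]

lemma exists_le_ratio_of_minimizer {A s : ℝ} (hA : 0 < A) (hs : s ∈ Ioo (0:ℝ) (1/2)) {f : W22}
    (hf : MemG (coneObstacle A s) f)
    (hmin : ∀ v : W22, MemG (coneObstacle A s) v → graphE f ≤ graphE v)
    (hdu : f.du (1/2) ≤ 0) : ∃ B > 0, A ≤ ratio B := by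
  have h : 0 < 1/2 - s := by linarith [hs.2]
  have hs0 := hs.1
  obtain ⟨l, hl⟩ := exists_du_eq_of_minimizer hf hmin
    (κ := 2 * (A / (1/2 - s)) * s) (by positivity)
    fun x hx => coneObstacle_add_le hs.2 hf (antitoneOn_du_of_minimizer hf hmin) hx
  have h2 := hf.2.2 (1/2) ⟨by norm_num, by norm_num⟩
  rw [coneObstacle_half hs.2] at h2
  exact exists_le_ratio hA hf.1 h2 hdu hl

/-- Nonexistence of graph minimizers for large symmetric cone obstacles.
`sup_{B>0} R(B)` is finite, and if `sup_{(0,1)} ψ > sup_{B>0} R(B)` then the infimum of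
the elastic energy over `G_ψ` is not attained. -/
theorem stmt0 (A s : ℝ) (hA : 0 < A) (hs : s ∈ Ioo (0:ℝ) (1/2)) :
    BddAbove (ratio '' Ioi 0) ∧
    (sSup (ratio '' Ioi 0) < sSup (coneObstacle A s '' Ioo 0 1) →
      ¬ ∃ u : W22, MemG (coneObstacle A s) u ∧
        ∀ v : W22, MemG (coneObstacle A s) v → graphE u ≤ graphE v) := by
  refine ⟨bddAbove_ratio, ?_⟩
  rintro hlt ⟨f, hf, hmin⟩
  have hcone : sSup (coneObstacle A s '' Ioo 0 1) ≤ A := by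
    refine csSup_le ⟨_, 1/2, ⟨by norm_num, by norm_num⟩, rfl⟩ ?_
    rintro _ ⟨x, _, rfl⟩
    exact coneObstacle_le hA hs.2
  obtain ⟨B, hB, hAB⟩ : ∃ B > 0, A ≤ ratio B := by
    rcases le_total (f.du (1/2)) 0 with h | h
    · exact exists_le_ratio_of_minimizer hA hs hf hmin h
    · refine exists_le_ratio_of_minimizer hA hs
        (W22.memG_reflect (coneObstacle_one_sub A s) hf)
        (fun v hv => (W22.graphE_reflect f).trans_le (hmin v hv)) ?_
      change -f.du (1 - 1/2) ≤ 0
      norm_num at h ⊢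
      exact h
  linarith [le_csSup bddAbove_ratio (mem_image_of_mem ratio hB)]
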